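/- (Positivity of the 2-D finite difference scheme.) Let ŵ ∈ (0,1), Δt, Δx, Δy > 0, and αˣ, αʸ > 0. Let (u_{ij})_{(i,j)∈ℤ²} be states in U_ad with αˣ ≥ αˣ(u_{ij}) and αʸ ≥ αʸ(u_{ij}) for all i,j. For each x-face let αˣ_{i+½,j} ∈ (0, αˣ] and wˣ'⁺_{i+½,j}, wˣ'⁻_{i+½,j} ∈ U_ad, and for each y-face let αʸ_{i,j+½} ∈ (0, αʸ] and wʸ'⁺_{i,j+½}, wʸ'⁻_{i,j+½} ∈ U_ad. Define wˣ'±_{ij} = ½(u_{ij} ± f(u_{ij})/αˣ(u_{ij})), wʸ'±_{ij} = ½(u_{ij} ± g(u_{ij})/αʸ(u_{ij})), and q-states qˣ'⁺_{ij} = (wˣ'⁺_{ij} − ŵ·wˣ'⁺_{i+½,j})/(1−ŵ), qˣ'⁻_{ij} = (wˣ'⁻_{ij} − ŵ·wˣ'⁻_{i−½,j})/(1−ŵ), and analogously qʸ'±_{ij} in the y-direction. Assume all these q-states belong to U_ad and that (αˣ/Δx + αʸ/Δy)·Δt ≤ ŵ. Then for every (i,j) the forward Euler update u_{ij} − (Δt/Δx)(F_{i+½,j}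 − F_{i−½,j}) − (Δt/Δy)(G_{i,j+½} − G_{i,j−½}) belongs to U_ad, where F_{i+½,j} = αˣ_{i+½,j}(wˣ'⁺_{i+½,j} − wˣ'⁻_{i+½,j}) and G_{i,j+½} = αʸ_{i,j+½}(wʸ'⁺_{i,j+½} − wʸ'⁻_{i,j+½}). -/

import Mathlib

noncomputable section

/-- Density of a Ten-Moment state. -/
def rho (u : Fin 6 → ℝ) : ℝ := u 0

/-- First velocity component. -/
def v1 (u : Fin 6 → ℝ) : ℝ := u 1 / u 0

/-- Second velocity component. -/
def v2 (u : Fin 6 → ℝ) : ℝ := u 2 / u 0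

/-- Pressure component `p₁₁`. -/
def p11 (u : Fin 6 → ℝ) : ℝ := 2 * u 3 - (u 1) ^ 2 / u 0

/-- Pressure component `p₁₂`. -/
def p12 (u : Fin 6 → ℝ) : ℝ := 2 * u 4 - u 1 * u 2 / u 0

/-- Pressure component `p₂₂`. -/
def p22 (u : Fin 6 → ℝ) : ℝ := 2 * u 5 - (u 2) ^ 2 / u 0

/-- The admissible set: positive density and positive definite pressure tensor. -/
def Uad : Set (Fin 6 → ℝ) :=
  {u | 0 < rho u ∧ 0 < p11 u ∧ 0 < p11 u * p22 u - (p12 u) ^ 2}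

/-- The x-direction flux of the Ten-Moment system. -/
def fluxX (u : Fin 6 → ℝ) : Fin 6 → ℝ :=
  ![rho u * v1 u,
    rho u * (v1 u) ^ 2 + p11 u,
    rho u * v1 u * v2 u + p12 u,
    (u 3 + p11 u) * v1 u,
    u 4 * v1 u + (p11 u * v2 u + p12 u * v1 u) / 2,
    u 5 * v1 u + p12 u * v2 u]

/-- The maximal wave speed in the x-direction. -/
def alphaX (u : Fin 6 → ℝ) : ℝ := |v1 u| + Real.sqrt (3 * p11 u / rho u)

/-- The y-direction flux of the Ten-Moment system. -/
def fluxY (u : Fin 6 → ℝ) : Fin 6 → ℝ :=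
  ![rho u * v2 u,
    rho u * v1 u * v2 u + p12 u,
    rho u * (v2 u) ^ 2 + p22 u,
    u 3 * v2 u + p12 u * v1 u,
    u 4 * v2 u + (p12 u * v2 u + p22 u * v1 u) / 2,
    (u 5 + p22 u) * v2 u]

/-- The maximal wave speed in the y-direction. -/
def alphaY (u : Fin 6 → ℝ) : ℝ := |v2 u| + Real.sqrt (3 * p22 u / rho u)

/-- The positive x-split part of a state. -/
def wXp (u : Fin 6 → ℝ) : Fin 6 → ℝ := (2 : ℝ)⁻¹ • (u + (alphaX u)⁻¹ • fluxX u)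

/-- The negative x-split part of a state. -/
def wXm (u : Fin 6 → ℝ) : Fin 6 → ℝ := (2 : ℝ)⁻¹ • (u - (alphaX u)⁻¹ • fluxX u)

/-- The positive y-split part of a state. -/
def wYp (u : Fin 6 → ℝ) : Fin 6 → ℝ := (2 : ℝ)⁻¹ • (u + (alphaY u)⁻¹ • fluxY u)

/-- The negative y-split part of a state. -/
def wYm (u : Fin 6 → ℝ) : Fin 6 → ℝ := (2 : ℝ)⁻¹ • (u - (alphaY u)⁻¹ • fluxY u)

/-- Admissibility is positive definiteness of a quadratic form that is linear in the state. -/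
theorem mem_Uad_iff (u : Fin 6 → ℝ) :
    u ∈ Uad ↔ ∀ a b c : ℝ, (a ≠ 0 ∨ b ≠ 0 ∨ c ≠ 0) →
      0 < a ^ 2 * (2 * u 3) + 2 * a * b * (2 * u 4) + b ^ 2 * (2 * u 5)
        + 2 * c * (a * u 1 + b * u 2) + c ^ 2 * u 0 := by
  constructor
  · rintro ⟨hr, hp, hd⟩ a b c hne
    have hr : 0 < u 0 := hr
    have key : a ^ 2 * (2 * u 3) + 2 * a * b * (2 * u 4) + b ^ 2 * (2 * u 5)
        + 2 * c * (a * u 1 + b * u 2) + c ^ 2 * u 0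
        = u 0 * (c + (a * u 1 + b * u 2) / u 0) ^ 2 + p11 u * (a + b * p12 u / p11 u) ^ 2
          + b ^ 2 * (p11 u * p22 u - p12 u ^ 2) / p11 u := by
      have h : p11 u * (a + b * p12 u / p11 u) ^ 2
          + b ^ 2 * (p11 u * p22 u - p12 u ^ 2) / p11 u
          = a ^ 2 * p11 u + 2 * a * b * p12 u + b ^ 2 * p22 u := by
        field_simp
        ring
      rw [add_assoc (u 0 * _), h]
      simp only [p11, p12, p22]
      field_simp
      ring
    rw [key]
    by_cases hb : b = 0
    · by_cases ha : a = 0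
      · have hc : c ≠ 0 := by tauto
        subst ha hb
        simp only [zero_mul, add_zero, zero_div]
        positivity
      · subst hb
        simp only [zero_mul, add_zero, zero_div]
        positivity
    · positivity
  · intro h
    have hr : 0 < u 0 := by simpa using h 0 0 1 (by simp)
    have hp : 0 < p11 u := by
      refine (h 1 0 (-(u 1 / u 0)) (by simp)).trans_eq ?_
      simp only [p11]
      field_simp
      ring
    refine ⟨hr, hp, pos_of_mul_pos_right (a := p11 u) ?_ hp.le⟩
    refine (h (-p12 u) (p11 u) (-((-p12 u * u 1 + p11 u * u 2) / u 0))
      (Or.inr (Or.inl hp.ne'))).trans_eq ?_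
    simp only [p11, p12, p22]
    field_simp
    ring

theorem add_mem_Uad {u v : Fin 6 → ℝ} (hu : u ∈ Uad) (hv : v ∈ Uad) : u + v ∈ Uad := by
  rw [mem_Uad_iff] at *
  intro a b c hne
  refine (add_pos (hu a b c hne) (hv a b c hne)).trans_eq ?_
  simp only [Pi.add_apply]
  ring

theorem smul_mem_Uad {u : Fin 6 → ℝ} {r : ℝ} (hr : 0 < r) (hu : u ∈ Uad) : r • u ∈ Uad := by
  rw [mem_Uad_iff] at *
  intro a b c hne
  refine (mul_pos hr (hu a b c hne)).trans_eq ?_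
  simp only [Pi.smul_apply, smul_eq_mul]
  ring

theorem add_smul_mem_Uad {u v : Fin 6 → ℝ} {r : ℝ} (hr : 0 ≤ r) (hu : u ∈ Uad)
    (hv : v ∈ Uad) : u + r • v ∈ Uad := by
  rcases hr.eq_or_lt with rfl | hr
  · simpa using hu
  · exact add_mem_Uad hu (smul_mem_Uad hr hv)

theorem wXp_add_wXm (u : Fin 6 → ℝ) : wXp u + wXm u = u := by
  unfold wXp wXm
  module

theorem wYp_add_wYm (u : Fin 6 → ℝ) : wYp u + wYm u = u := by
  unfold wYp wYm
  module

/-- A weighted one-dimensional flux-split update is admissible. The state is `P + M`, the split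
states at the right face are `wp`, `wm`, and those at the left face are `wp'`, `wm'`. -/
theorem splitUpdate_mem_Uad {P M wp wm wp' wm' : Fin 6 → ℝ} {w r a a' A θ : ℝ} (hw : w < 1)
    (hr : 0 < r) (hθ : 0 < θ) (hcfl : r * A ≤ θ * w)
    (ha : a ∈ Set.Ioc 0 A) (ha' : a' ∈ Set.Ioc 0 A)
    (hwp : wp ∈ Uad) (hwm : wm ∈ Uad) (hwp' : wp' ∈ Uad) (hwm' : wm' ∈ Uad)
    (hP : (1 - w)⁻¹ • (P - w • wp) ∈ Uad) (hM : (1 - w)⁻¹ • (M - w • wm') ∈ Uad) :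
    θ • (P + M) - r • (a • (wp - wm) - a' • (wp' - wm')) ∈ Uad := by
  have hw' : 0 < 1 - w := sub_pos.2 hw
  have hP' := smul_mem_Uad hw' hP
  have hM' := smul_mem_Uad hw' hM
  rw [smul_inv_smul₀ hw'.ne'] at hP' hM'
  have h1 : 0 ≤ θ * w - r * a := by
    linarith [mul_le_mul_of_nonneg_left ha.2 hr.le]
  have h2 : 0 ≤ θ * w - r * a' := by
    linarith [mul_le_mul_of_nonneg_left ha'.2 hr.le]
  have h := add_smul_mem_Uad h1 (add_smul_mem_Uad h2 (add_smul_mem_Uad (mul_pos hr ha.1).le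
    (add_smul_mem_Uad (mul_pos hr ha'.1).le (smul_mem_Uad hθ (add_mem_Uad hP' hM'))
      hwp') hwm) hwm') hwp
  convert h using 1
  module

/-- Positivity of the 2-D finite difference scheme: under the CFL condition
`(αˣ/Δx + αʸ/Δy) Δt ≤ ŵ` and admissibility of all face and `q*` states, the 2-D
forward Euler update is admissible. The x-face `(i+½, j)` is indexed by `(i, j)`
and the y-face `(i, j+½)` by `(i, j)`. -/
theorem fd2d_forwardEuler_positivity (what dt dx dy ax ay : ℝ)
    (hwhat : what ∈ Set.Ioo (0 : ℝ) 1)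
    (hdt : 0 < dt) (hdx : 0 < dx) (hdy : 0 < dy) (hax : 0 < ax) (hay : 0 < ay)
    (u : ℤ → ℤ → Fin 6 → ℝ) (hu : ∀ i j, u i j ∈ Uad)
    (haxu : ∀ i j, alphaX (u i j) ≤ ax) (hayu : ∀ i j, alphaY (u i j) ≤ ay)
    (afx afy : ℤ → ℤ → ℝ)
    (hafx : ∀ i j, afx i j ∈ Set.Ioc (0 : ℝ) ax)
    (hafy : ∀ i j, afy i j ∈ Set.Ioc (0 : ℝ) ay)
    (wxp wxm wyp wym : ℤ → ℤ → Fin 6 → ℝ)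
    (hwxp : ∀ i j, wxp i j ∈ Uad) (hwxm : ∀ i j, wxm i j ∈ Uad)
    (hwyp : ∀ i j, wyp i j ∈ Uad) (hwym : ∀ i j, wym i j ∈ Uad)
    (hqxp : ∀ i j, (1 - what)⁻¹ • (wXp (u i j) - what • wxp i j) ∈ Uad)
    (hqxm : ∀ i j, (1 - what)⁻¹ • (wXm (u i j) - what • wxm (i - 1) j) ∈ Uad)
    (hqyp : ∀ i j, (1 - what)⁻¹ • (wYp (u i j) - what • wyp i j) ∈ Uad)
    (hqym : ∀ i j, (1 - what)⁻¹ • (wYm (u i j) - what • wym i (j - 1)) ∈ Uad)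
    (hcfl : (ax / dx + ay / dy) * dt ≤ what) :
    ∀ i j,
      u i j
        - (dt / dx) • (afx i j • (wxp i j - wxm i j)
            - afx (i - 1) j • (wxp (i - 1) j - wxm (i - 1) j))
        - (dt / dy) • (afy i j • (wyp i j - wym i j)
            - afy i (j - 1) • (wyp i (j - 1) - wym i (j - 1))) ∈ Uad := by
  intro i j
  have hx : 0 < dt / dx * ax := by positivity
  have hy : 0 < dt / dy * ay := by positivity
  have hsum : dt / dx * ax + dt / dy * ay ≤ what := by
    refine le_of_eq_of_le ?_ hcfl
    ring
  set S := dt / dx * ax + dt / dy * ay with hS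
  have hS0 : 0 < S := add_pos hx hy
  have hθ : dt / dx * ax / S + dt / dy * ay / S = 1 := by
    rw [← add_div, ← hS, div_self hS0.ne']
  have weight_le {t : ℝ} (ht : 0 < t) : t ≤ t / S * what := by
    rw [div_mul_eq_mul_div, le_div_iff₀ hS0]
    exact mul_le_mul_of_nonneg_left hsum ht.le
  have hX := splitUpdate_mem_Uad hwhat.2 (div_pos hdt hdx) (div_pos hx hS0) (weight_le hx)
    (hafx i j) (hafx (i - 1) j) (hwxp i j) (hwxm i j) (hwxp (i - 1) j) (hwxm (i - 1) j)
    (hqxp i j) (hqxm i j)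
  have hY := splitUpdate_mem_Uad hwhat.2 (div_pos hdt hdy) (div_pos hy hS0) (weight_le hy)
    (hafy i j) (hafy i (j - 1)) (hwyp i j) (hwym i j) (hwyp i (j - 1)) (hwym i (j - 1))
    (hqyp i j) (hqym i j)
  rw [wXp_add_wXm] at hX
  rw [wYp_add_wYm] at hY
  convert add_mem_Uad hX hY using 1
  rw [sub_add_sub_comm, ← add_smul, hθ, one_smul, sub_sub]
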